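/- arXiv:1512.07062 — 5 statements merged into one kernel-verified Lean document; each statement's English description precedes it below -/
import Mathlib

section
/- If a point (x, y, z) ∈ ℂ³ satisfies f(x, y, z) = 0 and is a critical point of f (i.e. ∂f/∂x, ∂f/∂y and ∂f/∂z all vanish at (x, y, z)), then (x, y, z) = (0, 0, 0). In other words, the origin is the only singular point of the hypersurface {f = 0} ⊂ ℂ³. (Claim of Section 4.1.) -/
theorem hasDerivAt_pow_five_add_mul_add (a b x : ℂ) :
    HasDerivAt (fun s : ℂ => s ^ 5 + a * s + b) (5 * x ^ 4 + a) x := by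
  simpa using ((hasDerivAt_pow 5 x).add ((hasDerivAt_id x).const_mul a)).add_const b

theorem hasDerivAt_pow_five_add_mul_sq_add (a b x : ℂ) :
    HasDerivAt (fun s : ℂ => s ^ 5 + a * s ^ 2 + b) (5 * x ^ 4 + a * (2 * x)) x := by
  simpa using ((hasDerivAt_pow 5 x).add ((hasDerivAt_pow 2 x).const_mul a)).add_const b

/-- Section 4.1: for `f(x,y,z) = x⁵ + y⁵ + z⁵ + λ·x·y·z²` with `λ ≠ 0`, the origin is the
only singular point of the hypersurface `{f = 0} ⊂ ℂ³`. -/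
theorem statement_9 (lam : ℂ) (hlam : lam ≠ 0)
    (f : ℂ → ℂ → ℂ → ℂ)
    (hf : ∀ x y z : ℂ, f x y z = x ^ 5 + y ^ 5 + z ^ 5 + lam * x * y * z ^ 2)
    (x y z : ℂ)
    (h0 : f x y z = 0)
    (hx : deriv (fun s => f s y z) x = 0)
    (hy : deriv (fun s => f x s z) y = 0)
    (hz : deriv (fun s => f x y s) z = 0) :
    x = 0 ∧ y = 0 ∧ z = 0 := by
  have ex : (fun s => f s y z) = fun s => s ^ 5 + (lam * y * z ^ 2) * s + (y ^ 5 + z ^ 5) := by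
    funext s; rw [hf]; ring
  have ey : (fun s => f x s z) = fun s => s ^ 5 + (lam * x * z ^ 2) * s + (x ^ 5 + z ^ 5) := by
    funext s; rw [hf]; ring
  have ez : (fun s => f x y s) = fun s => s ^ 5 + (lam * x * y) * s ^ 2 + (x ^ 5 + y ^ 5) := by
    funext s; rw [hf]; ring
  rw [ex, (hasDerivAt_pow_five_add_mul_add _ _ _).deriv] at hx
  rw [ey, (hasDerivAt_pow_five_add_mul_add _ _ _).deriv] at hy
  rw [ez, (hasDerivAt_pow_five_add_mul_sq_add _ _ _).deriv] at hz
  rw [hf] at h0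
  -- Euler's relation: the mixed monomial is `5 f - x ∂f/∂x - y ∂f/∂y - z ∂f/∂z`.
  have hm : lam * x * y * z ^ 2 = 0 := by
    linear_combination 5 * h0 - x * hx - y * hy - z * hz
  refine ⟨pow_eq_zero_iff (n := 5) (by norm_num) |>.1 ?_,
    pow_eq_zero_iff (n := 5) (by norm_num) |>.1 ?_,
    pow_eq_zero_iff (n := 5) (by norm_num) |>.1 ?_⟩
  · linear_combination (x * hx - hm) / 5
  · linear_combination (y * hy - hm) / 5
  · linear_combination (z * hz - 2 * hm) / 5
end

section
/- If a point (x, y, z) ∈ ℂ³ satisfies f(x, y, z) = 0 and is a critical point of f (i.e. ∂f/∂x, ∂f/∂y and ∂f/∂z all vanish at (x, y, z)), then (x, y, z) = (0, 0, 0). In other words, the origin is the only singular point of the hypersurface {f = 0} ⊂ ℂ³. (Claim of Section 4.2.) -/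
/-- Section 4.2: for `f(x,y,z) = x·y³ + y·z³ + z·x³ + λ·x·y·z`, the origin is the only
singular point of the hypersurface `{f = 0} ⊂ ℂ³`. -/
theorem statement_11 (lam : ℂ)
    (f : ℂ → ℂ → ℂ → ℂ)
    (hf : ∀ x y z : ℂ, f x y z = x * y ^ 3 + y * z ^ 3 + z * x ^ 3 + lam * x * y * z)
    (x y z : ℂ)
    (h0 : f x y z = 0)
    (hx : deriv (fun s => f s y z) x = 0)
    (hy : deriv (fun s => f x s z) y = 0)
    (hz : deriv (fun s => f x y s) z = 0) :
    x = 0 ∧ y = 0 ∧ z = 0 := by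
  simp only [hf] at h0 hx hy hz
  have deriv_cubic (a b c d t : ℂ) :
      deriv (fun s => a * s ^ 3 + b * s + c * s + d) t = 3 * a * t ^ 2 + b + c := by
    have h := ((((hasDerivAt_pow 3 t).const_mul a).add ((hasDerivAt_id t).const_mul b)).add
      ((hasDerivAt_id t).const_mul c)).add_const d
    refine (h.congr_deriv ?_).deriv
    norm_num
    ring
  have ex : y ^ 3 + 3 * z * x ^ 2 + lam * y * z = 0 := by
    rw [← hx, show (fun s => s * y ^ 3 + y * z ^ 3 + z * s ^ 3 + lam * s * y * z) =
      fun s => z * s ^ 3 + y ^ 3 * s + lam * y * z * s + y * z ^ 3 by ext s; ring, deriv_cubic]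
    ring
  have ey : 3 * x * y ^ 2 + z ^ 3 + lam * x * z = 0 := by
    rw [← hy, show (fun s => x * s ^ 3 + s * z ^ 3 + z * x ^ 3 + lam * x * s * z) =
      fun s => x * s ^ 3 + z ^ 3 * s + lam * x * z * s + z * x ^ 3 by ext s; ring, deriv_cubic]
  have ez : 3 * y * z ^ 2 + x ^ 3 + lam * x * y = 0 := by
    rw [← hz, show (fun s => x * y ^ 3 + y * s ^ 3 + s * x ^ 3 + lam * x * y * s) =
      fun s => y * s ^ 3 + x ^ 3 * s + lam * x * y * s + x * y ^ 3 by ext s; ring, deriv_cubic]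
  -- By Euler's identity the `λ`-term vanishes; the three monomials then solve a
  -- nonsingular linear system of determinant `28`.
  have hlam : lam * x * y * z = 0 := by
    linear_combination 4 * h0 - x * ex - y * ey - z * ez
  have hzx : z * x ^ 3 = 0 := by
    linear_combination (1 / 28) * (9 * x * ex - 3 * y * ey + z * ez - 7 * hlam)
  rcases mul_eq_zero.mp hzx with rfl | h
  · have hy0 : y = 0 := by simpa using ex
    subst hy0
    exact ⟨by simpa using ez, rfl, rfl⟩
  · obtain rfl : x = 0 := by simpa using h
    have hz0 : z = 0 := by simpa using ey
    subst hz0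
    exact ⟨rfl, by simpa using ex, rfl⟩
end

section
/- Each of the four polynomials x·y³, y·z³, z·x³ and λ·x·y·z lies in the ℂ-linear span of the four polynomials f, x·∂f/∂x, y·∂f/∂y, z·∂f/∂z inside ℂ[x, y, z]. (The key step in the proof of the claim of Section 4.2: every monomial of f is a linear combination of f and x·∂f/∂x, y·∂f/∂y, z·∂f/∂z, so each monomial of f vanishes on the singular set of {f = 0}.) -/
open MvPolynomial

/-- A linear combination of four vectors lies in their span. -/
lemma linearCombination_mem_span_four {R M : Type*} [Semiring R] [AddCommMonoid M] [Module R M]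
    (u v w t : M) (a b c d : R) :
    a • u + b • v + c • w + d • t ∈ Submodule.span R ({u, v, w, t} : Set M) := by
  refine add_mem (add_mem (add_mem ?_ ?_) ?_) ?_ <;>
    exact Submodule.smul_mem _ _ (Submodule.subset_span (by simp))

/-- Section 4.2, key step: each monomial of `f = x·y³ + y·z³ + z·x³ + λ·x·y·z` lies in the
`ℂ`-linear span of `f, x·∂f/∂x, y·∂f/∂y, z·∂f/∂z` in `ℂ[x,y,z]`. -/
theorem statement_12 (lam : ℂ)
    (f : MvPolynomial (Fin 3) ℂ)
    (hf : f = X 0 * X 1 ^ 3 + X 1 * X 2 ^ 3 + X 2 * X 0 ^ 3 + C lam * (X 0 * X 1 * X 2)) :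
    ∀ g ∈ ({X 0 * X 1 ^ 3, X 1 * X 2 ^ 3, X 2 * X 0 ^ 3,
        C lam * (X 0 * X 1 * X 2)} : Set (MvPolynomial (Fin 3) ℂ)),
      g ∈ Submodule.span ℂ
        ({f, X 0 * pderiv 0 f, X 1 * pderiv 1 f, X 2 * pderiv 2 f} :
          Set (MvPolynomial (Fin 3) ℂ)) := by
  have hx : X 0 * pderiv 0 f =
      X 0 * X 1 ^ 3 + 3 • (X 2 * X 0 ^ 3) + C lam * (X 0 * X 1 * X 2) := by
    simp [hf, pderiv_X]
    ring
  have hy : X 1 * pderiv 1 f =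
      X 1 * X 2 ^ 3 + 3 • (X 0 * X 1 ^ 3) + C lam * (X 0 * X 1 * X 2) := by
    simp [hf, pderiv_X]
    ring
  have hz : X 2 * pderiv 2 f =
      X 2 * X 0 ^ 3 + 3 • (X 1 * X 2 ^ 3) + C lam * (X 0 * X 1 * X 2) := by
    simp [hf, pderiv_X]
    ring
  have mem := linearCombination_mem_span_four (R := ℂ)
    f (X 0 * pderiv 0 f) (X 1 * pderiv 1 f) (X 2 * pderiv 2 f)
  rintro g (rfl | rfl | rfl | rfl)
  · convert mem (-1) (2 / 7) (4 / 7) (1 / 7) using 1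
    rw [hx, hy, hz, hf]
    module
  · convert mem (-1) (1 / 7) (2 / 7) (4 / 7) using 1
    rw [hx, hy, hz, hf]
    module
  · convert mem (-1) (4 / 7) (1 / 7) (2 / 7) using 1
    rw [hx, hy, hz, hf]
    module
  · convert mem 4 (-1) (-1) (-1) using 1
    rw [hx, hy, hz, hf]
    module
end

section
/- If a point (x, y, z, t) ∈ ℂ⁴ satisfies f(x, y, z, t) = 0 and is a critical point of f (i.e. ∂f/∂x, ∂f/∂y, ∂f/∂z and ∂f/∂t all vanish at (x, y, z, t)), then (x, y, z, t) = (0, 0, 0, 0). In other words, the hypersurface {f = 0} ⊂ ℂ⁴ has an isolated singularity at the origin. (Claim of Section 4.4.) -/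
/-- The derivative of a complex cubic polynomial function. -/
lemma deriv_cubic (a b c d s : ℂ) :
    deriv (fun s : ℂ => a * s ^ 3 + b * s ^ 2 + c * s + d) s
      = 3 * a * s ^ 2 + 2 * b * s + c := by
  have h := ((((hasDerivAt_pow 3 s).const_mul a).add
    ((hasDerivAt_pow 2 s).const_mul b)).add ((hasDerivAt_id s).const_mul c)).add_const d
  refine (HasDerivAt.deriv (h.congr_deriv ?_))
  norm_num
  ring

lemma eq_zero_of_sq_add_two_mul {x y : ℂ} (hx : y ^ 2 + 2 * x * y = 0)
    (hy : x ^ 2 + 2 * x * y = 0) : x = 0 ∧ y = 0 := by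
  have h : x ^ 4 = 0 := by
    linear_combination (-4 * x ^ 2 / 3) * hx + (x ^ 2 + 2 * x * y / 3) * hy
  have hx0 : x = 0 := pow_eq_zero_iff (by norm_num) |>.mp h
  subst hx0
  exact ⟨rfl, by simpa using hx⟩

lemma eq_zero_of_cube_add_three_mul {z t : ℂ} (hz : t ^ 3 + 3 * t * z ^ 2 = 0)
    (ht : z ^ 3 + 3 * z * t ^ 2 = 0) : z = 0 ∧ t = 0 := by
  have h : (z + t) ^ 3 = 0 := by linear_combination hz + ht
  have h' : (z - t) ^ 3 = 0 := by linear_combination ht - hz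
  have hs : z + t = 0 := pow_eq_zero_iff (by norm_num) |>.mp h
  have hd : z - t = 0 := pow_eq_zero_iff (by norm_num) |>.mp h'
  exact ⟨by linear_combination (hs + hd) / 2, by linear_combination (hs - hd) / 2⟩

theorem statement_13 (lam : ℂ) (hlam : lam ≠ 0)
    (f : ℂ → ℂ → ℂ → ℂ → ℂ)
    (hf : ∀ x y z t : ℂ,
      f x y z t = x * y ^ 2 + x ^ 2 * y + z * t ^ 3 + t * z ^ 3 + lam * x * y * z * t)
    (x y z t : ℂ)
    (h0 : f x y z t = 0)
    (hx : deriv (fun s => f s y z t) x = 0)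
    (hy : deriv (fun s => f x s z t) y = 0)
    (hz : deriv (fun s => f x y s t) z = 0)
    (ht : deriv (fun s => f x y z s) t = 0) :
    x = 0 ∧ y = 0 ∧ z = 0 ∧ t = 0 := by
  rw [hf] at h0
  rw [show (fun s => f s y z t) = fun s => 0 * s ^ 3 + y * s ^ 2 + (y ^ 2 + lam * y * z * t) * s
    + (z * t ^ 3 + t * z ^ 3) by funext s; rw [hf]; ring, deriv_cubic] at hx
  rw [show (fun s => f x s z t) = fun s => 0 * s ^ 3 + x * s ^ 2 + (x ^ 2 + lam * x * z * t) * s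
    + (z * t ^ 3 + t * z ^ 3) by funext s; rw [hf]; ring, deriv_cubic] at hy
  rw [show (fun s => f x y s t) = fun s => t * s ^ 3 + 0 * s ^ 2 + (t ^ 3 + lam * x * y * t) * s
    + (x * y ^ 2 + x ^ 2 * y) by funext s; rw [hf]; ring, deriv_cubic] at hz
  rw [show (fun s => f x y z s) = fun s => z * s ^ 3 + 0 * s ^ 2 + (z ^ 3 + lam * x * y * z) * s
    + (x * y ^ 2 + x ^ 2 * y) by funext s; rw [hf]; ring, deriv_cubic] at ht
  -- Euler's identity for the weights `(1/3, 1/3, 1/4, 1/4)` isolates the last monomial.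
  have euler : lam * (x * y * (z * t)) = 0 := by
    linear_combination 2 * x * hx + 2 * y * hy + 3 / 2 * z * hz + 3 / 2 * t * ht - 6 * h0
  rcases mul_eq_zero.mp ((mul_eq_zero.mp euler).resolve_left hlam) with hxy | hzt
  · obtain ⟨rfl, rfl⟩ := eq_zero_of_cube_add_three_mul (z := z) (t := t)
      (by linear_combination hz - lam * t * hxy) (by linear_combination ht - lam * z * hxy)
    obtain ⟨rfl, rfl⟩ := eq_zero_of_sq_add_two_mul (x := x) (y := y)
      (by linear_combination hx) (by linear_combination hy)
    simp
  · obtain ⟨rfl, rfl⟩ := eq_zero_of_sq_add_two_mul (x := x) (y := y)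
      (by linear_combination hx - lam * y * hzt) (by linear_combination hy - lam * x * hzt)
    obtain ⟨rfl, rfl⟩ := eq_zero_of_cube_add_three_mul (z := z) (t := t)
      (by linear_combination hz) (by linear_combination ht)
    simp
end

section
/- If a point p = (x, y, z, t) ∈ ℂ⁴ is a critical point of f (i.e. ∂f/∂x, ∂f/∂y, ∂f/∂z and ∂f/∂t all vanish at p), then at p one has x·y² = x²·y = −(1/3)·λ·x·y·z·t and z·t³ = z³·t = −(1/4)·λ·x·y·z·t. (The first step in the proof of the claim of Section 4.4: on the set Σ := {df = 0} these relations among the monomials of f hold.) -/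
theorem deriv_eq_of_eq_cubic {g : ℂ → ℂ} (a b c d : ℂ)
    (hg : ∀ s, g s = a * s ^ 3 + b * s ^ 2 + c * s + d) (s : ℂ) :
    deriv g s = 3 * a * s ^ 2 + 2 * b * s + c := by
  obtain rfl : g = fun s => a * s ^ 3 + b * s ^ 2 + c * s + d := funext hg
  have h := ((((hasDerivAt_pow 3 s).const_mul a).add ((hasDerivAt_pow 2 s).const_mul b)).add
    ((hasDerivAt_id s).const_mul c)).add_const d
  refine h.deriv.trans ?_
  push_cast
  ring

theorem statement_14 (lam : ℂ) (hlam : lam ≠ 0)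
    (f : ℂ → ℂ → ℂ → ℂ → ℂ)
    (hf : ∀ x y z t : ℂ,
      f x y z t = x * y ^ 2 + x ^ 2 * y + z * t ^ 3 + t * z ^ 3 + lam * x * y * z * t)
    (x y z t : ℂ)
    (hx : deriv (fun s => f s y z t) x = 0)
    (hy : deriv (fun s => f x s z t) y = 0)
    (hz : deriv (fun s => f x y s t) z = 0)
    (ht : deriv (fun s => f x y z s) t = 0) :
    x * y ^ 2 = -(1 / 3) * lam * (x * y * z * t) ∧
    x ^ 2 * y = -(1 / 3) * lam * (x * y * z * t) ∧
    z * t ^ 3 = -(1 / 4) * lam * (x * y * z * t) ∧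
    z ^ 3 * t = -(1 / 4) * lam * (x * y * z * t) := by
  rw [deriv_eq_of_eq_cubic 0 y (y ^ 2 + lam * y * z * t) (z * t ^ 3 + t * z ^ 3)
    (fun s => by rw [hf]; ring)] at hx
  rw [deriv_eq_of_eq_cubic 0 x (x ^ 2 + lam * x * z * t) (z * t ^ 3 + t * z ^ 3)
    (fun s => by rw [hf]; ring)] at hy
  rw [deriv_eq_of_eq_cubic t 0 (t ^ 3 + lam * x * y * t) (x * y ^ 2 + x ^ 2 * y)
    (fun s => by rw [hf]; ring)] at hz
  rw [deriv_eq_of_eq_cubic z 0 (z ^ 3 + lam * x * y * z) (x * y ^ 2 + x ^ 2 * y)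
    (fun s => by rw [hf]; ring)] at ht
  refine ⟨?_, ?_, ?_, ?_⟩
  · linear_combination (-1 / 3) * x * hx + (2 / 3) * y * hy
  · linear_combination (2 / 3) * x * hx - (1 / 3) * y * hy
  · linear_combination (-1 / 8) * z * hz + (3 / 8) * t * ht
  · linear_combination (3 / 8) * z * hz - (1 / 8) * t * ht
end
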